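/- For all ψ, b ∈ 𝒮(ℝ²) the following four integrals cancel exactly: ∫_{ℝ²} b·ψ_y·∂_xΔψ dxdy − ∫_{ℝ²} b·ψ_x·∂_yΔψ dxdy + ∫_{ℝ²} ∇ψ·∇(b_y ψ_x) dxdy − ∫_{ℝ²} ∇ψ·∇(b_x ψ_y) dxdy = 0. -/

import Mathlib

open MeasureTheory Real

/-- Horizontal partial derivative `∂_x` of a function on `ℝ²`. -/
noncomputable def pd1 (f : ℝ × ℝ → ℝ) : ℝ × ℝ → ℝ := fun p => fderiv ℝ f p ((1 : ℝ), (0 : ℝ))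

/-- Vertical partial derivative `∂_y` of a function on `ℝ²`. -/
noncomputable def pd2 (f : ℝ × ℝ → ℝ) : ℝ × ℝ → ℝ := fun p => fderiv ℝ f p ((0 : ℝ), (1 : ℝ))

/-- The Laplacian `Δ = ∂_x² + ∂_y²` on `ℝ²`. -/
noncomputable def lap (f : ℝ × ℝ → ℝ) : ℝ × ℝ → ℝ := fun p => pd1 (pd1 f) p + pd2 (pd2 f) p

namespace NTC
open SchwartzMap LineDeriv

/-- Schwartz `∂_x`. -/
noncomputable def D1 (f : SchwartzMap (ℝ × ℝ) ℝ) : SchwartzMap (ℝ × ℝ) ℝ :=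
  ∂_{((1 : ℝ), (0 : ℝ))} f

/-- Schwartz `∂_y`. -/
noncomputable def D2 (f : SchwartzMap (ℝ × ℝ) ℝ) : SchwartzMap (ℝ × ℝ) ℝ :=
  ∂_{((0 : ℝ), (1 : ℝ))} f

/-- Product of Schwartz functions. -/
noncomputable def M (f g : SchwartzMap (ℝ × ℝ) ℝ) : SchwartzMap (ℝ × ℝ) ℝ :=
  SchwartzMap.pairing (ContinuousLinearMap.mul ℝ ℝ) f g

lemma M_apply (f g : SchwartzMap (ℝ × ℝ) ℝ) (p : ℝ × ℝ) : M f g p = f p * g p := by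
  simp [M, SchwartzMap.pairing_apply_apply]

lemma M_coe (f g : SchwartzMap (ℝ × ℝ) ℝ) : (fun p => f p * g p) = ⇑(M f g) := by
  funext p; rw [M_apply]

lemma pd1_coe (f : SchwartzMap (ℝ × ℝ) ℝ) : pd1 ⇑f = ⇑(D1 f) := by
  funext p; simp [pd1, D1, SchwartzMap.lineDerivOp_apply_eq_fderiv]

lemma pd2_coe (f : SchwartzMap (ℝ × ℝ) ℝ) : pd2 ⇑f = ⇑(D2 f) := by
  funext p; simp [pd2, D2, SchwartzMap.lineDerivOp_apply_eq_fderiv]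

lemma lap_coe (f : SchwartzMap (ℝ × ℝ) ℝ) : lap ⇑f = ⇑(D1 (D1 f) + D2 (D2 f)) := by
  funext p; simp [lap, pd1_coe, pd2_coe]

lemma comm (f : SchwartzMap (ℝ × ℝ) ℝ) (p : ℝ × ℝ) : D1 (D2 f) p = D2 (D1 f) p := by
  have hs : IsSymmSndFDerivAt ℝ (⇑f) p := by
    apply ContDiffAt.isSymmSndFDerivAt (n := 2) (f.smooth 2).contDiffAt
    simp
  have hd : DifferentiableAt ℝ (fderiv ℝ ⇑f) p :=
    ((f.smooth 2).fderiv_right (m := 1) (by norm_num)).differentiable (by norm_num) p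
  rw [← pd1_coe, ← pd2_coe, ← pd2_coe, ← pd1_coe]
  unfold pd1 pd2
  rw [fderiv_clm_apply hd (by fun_prop), fderiv_clm_apply hd (by fun_prop)]
  simpa using hs.eq _ _

lemma D1_M (f g : SchwartzMap (ℝ × ℝ) ℝ) (p : ℝ × ℝ) :
    D1 (M f g) p = f p * D1 g p + g p * D1 f p := by
  rw [← pd1_coe, ← pd1_coe, ← pd1_coe, ← M_coe]
  unfold pd1
  rw [fderiv_fun_mul f.differentiableAt g.differentiableAt]
  simp

lemma D2_M (f g : SchwartzMap (ℝ × ℝ) ℝ) (p : ℝ × ℝ) :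
    D2 (M f g) p = f p * D2 g p + g p * D2 f p := by
  rw [← pd2_coe, ← pd2_coe, ← pd2_coe, ← M_coe]
  unfold pd2
  rw [fderiv_fun_mul f.differentiableAt g.differentiableAt]
  simp

lemma ibp1 (f g : SchwartzMap (ℝ × ℝ) ℝ) : ∫ p, f p * D1 g p = - ∫ p, D1 f p * g p :=
  SchwartzMap.integral_mul_lineDerivOp_right_eq_neg_left f g _

lemma ibp2 (f g : SchwartzMap (ℝ × ℝ) ℝ) : ∫ p, f p * D2 g p = - ∫ p, D2 f p * g p :=
  SchwartzMap.integral_mul_lineDerivOp_right_eq_neg_left f g _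

lemma intM (f g : SchwartzMap (ℝ × ℝ) ℝ) : Integrable (fun p => f p * g p) := by
  rw [M_coe]; exact (M f g).integrable

lemma grad (ψ F : SchwartzMap (ℝ × ℝ) ℝ) :
    ∫ p, (D1 ψ p * D1 F p + D2 ψ p * D2 F p)
      = - ∫ p, F p * (D1 (D1 ψ) + D2 (D2 ψ)) p := by
  rw [integral_add (intM _ _) (intM _ _), ibp1, ibp2, ← neg_add,
    ← integral_add (intM _ _) (intM _ _)]
  congr 2
  funext p
  simp only [_root_.add_apply]
  ring

end NTC

open NTC in
/-- for Schwartz functions `ψ, b` on `ℝ²`, the four nonlinear terms of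
the basic energy estimate cancel exactly:
`∫ b ψ_y ∂_xΔψ − ∫ b ψ_x ∂_yΔψ + ∫ ∇ψ·∇(b_y ψ_x) − ∫ ∇ψ·∇(b_x ψ_y) = 0`. -/
theorem nonlinear_terms_cancellation (ψ b : SchwartzMap (ℝ × ℝ) ℝ) :
    (∫ p : ℝ × ℝ, b p * pd2 (⇑ψ) p * pd1 (lap (⇑ψ)) p)
      - (∫ p : ℝ × ℝ, b p * pd1 (⇑ψ) p * pd2 (lap (⇑ψ)) p)
      + (∫ p : ℝ × ℝ,
          (pd1 (⇑ψ) p * pd1 (fun q => pd2 (⇑b) q * pd1 (⇑ψ) q) p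
            + pd2 (⇑ψ) p * pd2 (fun q => pd2 (⇑b) q * pd1 (⇑ψ) q) p))
      - (∫ p : ℝ × ℝ,
          (pd1 (⇑ψ) p * pd1 (fun q => pd1 (⇑b) q * pd2 (⇑ψ) q) p
            + pd2 (⇑ψ) p * pd2 (fun q => pd1 (⇑b) q * pd2 (⇑ψ) q) p)) = 0 := by
  simp only [lap_coe, pd1_coe, pd2_coe, M_coe]
  simp only [pd1_coe, pd2_coe, grad]
  set L := D1 (D1 ψ) + D2 (D2 ψ) with hL
  simp only [← M_apply b]
  rw [ibp1, ibp2]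
  have h : ∫ p, (D1 (M b (D2 ψ)) p * L p - D2 (M b (D1 ψ)) p * L p)
      = ∫ p, (M (D1 b) (D2 ψ) p * L p - M (D2 b) (D1 ψ) p * L p) := by
    congr 1
    funext p
    rw [D1_M, D2_M, comm, M_apply, M_apply]
    ring
  rw [integral_sub (intM _ _) (intM _ _), integral_sub (intM _ _) (intM _ _)] at h
  linarith
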